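/- Every Eisenstein root lattice (positive-definite E-lattice L with ⟨L,L⟩ ⊆ θE spanned by its norm-3 vectors) is an orthogonal direct sum of copies of A₂^E, D₄^E, E₆^E, and E₈^E. -/

import Mathlib

noncomputable section

def ω : ℂ := -1/2 + (Real.sqrt 3 / 2) * Complex.I
def θ : ℂ := ω - (starRingEnd ℂ) ω
def Eis : Subring ℂ := Subring.closure {ω}

/-- The standard Hermitian form on `ℂ^k`. -/
def hermF {k : ℕ} (x y : Fin k → ℂ) : ℂ := ∑ i, x i * (starRingEnd ℂ) (y i)

/-- `A₂^E = θ·Eis ⊆ ℂ¹`. -/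
def A2L : Set (Fin 1 → ℂ) := {x | ∃ e ∈ Eis, x 0 = θ * e}

/-- `D₄^E = {(x,x,y) ∈ Eis³ : x ≡ y mod θ}`. -/
def D4L : Set (Fin 3 → ℂ) :=
  {x | (∀ i, x i ∈ Eis) ∧ x 0 = x 1 ∧ ∃ e ∈ Eis, x 0 - x 2 = θ * e}

/-- `E₆^E = {(x,y,z) ∈ Eis³ : x ≡ y ≡ z mod θ}`. -/
def E6L : Set (Fin 3 → ℂ) :=
  {x | (∀ i, x i ∈ Eis) ∧ (∃ e ∈ Eis, x 0 - x 1 = θ * e) ∧ ∃ e ∈ Eis, x 1 - x 2 = θ * e}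

/-- The tetracode `C₄ ⊆ 𝔽₃⁴`. -/
def tetracode : Submodule (ZMod 3) (Fin 4 → ZMod 3) :=
  Submodule.span (ZMod 3) {![0, 1, 1, 1], ![1, 0, 1, -1]}

/-- `E₈^E = {x ∈ Eis⁴ : x mod θ ∈ C₄}`. -/
def E8L : Set (Fin 4 → ℂ) :=
  {x | (∀ i, x i ∈ Eis) ∧
    ∃ c ∈ tetracode, ∀ i, ∃ e ∈ Eis, x i - ((c i).val : ℂ) = θ * e}

/-- Isometry of Eisenstein lattices sitting in standard Hermitian spaces. -/
def LatIsom {n m : ℕ} (L : Set (Fin n → ℂ)) (M : Set (Fin m → ℂ)) : Prop :=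
  ∃ f : (Fin n → ℂ) → (Fin m → ℂ),
    Set.BijOn f L M ∧
    (∀ x ∈ L, ∀ y ∈ L, f (x + y) = f x + f y) ∧
    (∀ x ∈ L, f (ω • x) = ω • f x) ∧
    ∀ x ∈ L, ∀ y ∈ L, hermF (f x) (f y) = hermF x y

open scoped ComplexConjugate

/-! ### The Eisenstein integers -/

lemma omega_sq : ω ^ 2 = -1 - ω := by
  have h : ((Real.sqrt 3 : ℝ) : ℂ) ^ 2 = 3 := by
    rw [← Complex.ofReal_pow, Real.sq_sqrt (by norm_num)]; norm_num
  unfold ω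
  linear_combination (1 / 4 : ℂ) * Complex.I ^ 2 * h + (3 / 4 : ℂ) * Complex.I_sq

lemma conj_omega : conj ω = -1 - ω := by
  simp only [ω, map_add, map_mul, map_div₀, map_neg, map_one, Complex.conj_ofReal,
    Complex.conj_I, map_ofNat]
  ring

lemma theta_eq : θ = 2 * ω + 1 := by
  rw [θ, conj_omega]; ring

lemma theta_sq : θ * θ = -3 := by
  rw [theta_eq]; linear_combination 4 * omega_sq

lemma theta_ne_zero : θ ≠ 0 := by
  intro h
  have := theta_sq
  rw [h] at this
  norm_num at this

lemma conj_theta : conj θ = -θ := by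
  simp [θ]

lemma omega_mem : ω ∈ Eis := Subring.subset_closure rfl

lemma theta_mem : θ ∈ Eis := by
  rw [theta_eq, two_mul]
  exact add_mem (add_mem omega_mem omega_mem) (one_mem _)

lemma mem_Eis_iff {z : ℂ} : z ∈ Eis ↔ ∃ a b : ℤ, z = a + b * ω := by
  constructor
  · intro hz
    induction hz using Subring.closure_induction with
    | mem x hx => exact ⟨0, 1, by rw [Set.mem_singleton_iff.1 hx]; simp⟩
    | zero => exact ⟨0, 0, by simp⟩
    | one => exact ⟨1, 0, by simp⟩
    | add x y _ _ hx hy =>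
      obtain ⟨a, b, rfl⟩ := hx
      obtain ⟨c, d, rfl⟩ := hy
      exact ⟨a + c, b + d, by push_cast; ring⟩
    | neg x _ hx =>
      obtain ⟨a, b, rfl⟩ := hx
      exact ⟨-a, -b, by push_cast; ring⟩
    | mul x y _ _ hx hy =>
      obtain ⟨a, b, rfl⟩ := hx
      obtain ⟨c, d, rfl⟩ := hy
      exact ⟨a * c - b * d, a * d + b * c - b * d, by
        push_cast; linear_combination (b * d : ℂ) * omega_sq⟩
  · rintro ⟨a, b, rfl⟩
    exact add_mem (intCast_mem _ a) (mul_mem (intCast_mem _ b) omega_mem)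

lemma conj_mem_Eis {z : ℂ} (hz : z ∈ Eis) : conj z ∈ Eis := by
  obtain ⟨a, b, rfl⟩ := mem_Eis_iff.1 hz
  refine mem_Eis_iff.2 ⟨a - b, -b, ?_⟩
  simp only [map_add, map_mul, map_intCast, conj_omega]
  push_cast; ring

/-- The prime ideal `θ·Eis`, as an `Eis`-submodule of `ℂ`. -/
def thetaEis : Submodule Eis ℂ where
  carrier := {z | ∃ e ∈ Eis, z = θ * e}
  zero_mem' := ⟨0, zero_mem _, by simp⟩
  add_mem' := by
    rintro _ _ ⟨e, he, rfl⟩ ⟨f, hf, rfl⟩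
    exact ⟨e + f, add_mem he hf, by ring⟩
  smul_mem' := by
    rintro ⟨c, hc⟩ _ ⟨e, he, rfl⟩
    exact ⟨c * e, mul_mem hc he, by rw [Subring.smul_def, smul_eq_mul]; ring⟩

lemma mem_thetaEis {z : ℂ} : z ∈ thetaEis ↔ ∃ e ∈ Eis, z = θ * e := Iff.rfl

lemma theta_mem_thetaEis : θ ∈ thetaEis := ⟨1, one_mem _, by simp⟩

lemma theta_mul_mem {e : ℂ} (he : e ∈ Eis) : θ * e ∈ thetaEis := ⟨e, he, rfl⟩

lemma smul_mem_of_mem_Eis {V : Type*} [AddCommGroup V] [Module ℂ V] (L : Submodule Eis V)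
    {c : ℂ} (hc : c ∈ Eis) {x : V} (hx : x ∈ L) : c • x ∈ L :=
  L.smul_mem ⟨c, hc⟩ hx

lemma mul_mem_thetaEis {c z : ℂ} (hc : c ∈ Eis) (hz : z ∈ thetaEis) : c * z ∈ thetaEis :=
  smul_mem_of_mem_Eis thetaEis hc hz

lemma three_mul_mem_thetaEis {e : ℂ} (he : e ∈ Eis) : 3 * e ∈ thetaEis :=
  ⟨-(θ * e), neg_mem (mul_mem theta_mem he), by linear_combination e * theta_sq⟩

lemma mem_Eis_of_conj_theta_mul {z : ℂ} (hz : conj θ * z ∈ thetaEis) : z ∈ Eis := by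
  obtain ⟨e, he, h⟩ := hz
  have : z = -e := mul_left_cancel₀ theta_ne_zero (by
    rw [conj_theta] at h; linear_combination -h)
  exact this ▸ neg_mem he

lemma exists_int_sub_mem_thetaEis {z : ℂ} (hz : z ∈ Eis) :
    ∃ a : ℤ, z - a ∈ thetaEis := by
  obtain ⟨a, b, rfl⟩ := mem_Eis_iff.1 hz
  refine ⟨a + b, b * (ω + 1), mul_mem (intCast_mem _ b) (add_mem omega_mem (one_mem _)), ?_⟩
  rw [theta_eq]
  push_cast
  linear_combination (-2 * b : ℂ) * omega_sq

lemma intCast_mem_thetaEis_of_dvd {a : ℤ} (h : (3 : ℤ) ∣ a) : (a : ℂ) ∈ thetaEis := by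
  obtain ⟨k, rfl⟩ := h
  push_cast
  exact three_mul_mem_thetaEis (intCast_mem _ k)

lemma omega_im_ne_zero : ω.im ≠ 0 := by
  simp [ω]

lemma int_add_omega_eq_zero {a b : ℤ} (h : (a : ℂ) + b * ω = 0) : a = 0 ∧ b = 0 := by
  have hb : b = 0 := by
    have := congrArg Complex.im h
    simpa [omega_im_ne_zero] using this
  subst hb
  exact ⟨by simpa using h, rfl⟩

lemma dvd_of_intCast_mem_thetaEis {a : ℤ} (h : (a : ℂ) ∈ thetaEis) : (3 : ℤ) ∣ a := by
  obtain ⟨e, he, h⟩ := h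
  obtain ⟨c, d, rfl⟩ := mem_Eis_iff.1 he
  rw [theta_eq] at h
  have := int_add_omega_eq_zero (a := a - c + 2 * d) (b := d - 2 * c) (by
    push_cast; linear_combination h + (2 * d : ℂ) * omega_sq)
  omega

/-- A self-conjugate element of `θ·Eis` is a rational integer divisible by `3`. -/
lemma exists_eq_three_mul_of_conj_eq {z : ℂ} (hz : z ∈ thetaEis) (hc : conj z = z) :
    ∃ k : ℤ, z = 3 * k := by
  obtain ⟨e, he, rfl⟩ := hz
  obtain ⟨c, d, rfl⟩ := mem_Eis_iff.1 he
  simp only [map_add, map_mul, map_intCast, conj_theta, conj_omega] at hc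
  have h0 : (((2 * c - d : ℤ) : ℂ)) = 0 := mul_left_cancel₀ theta_ne_zero (by
    push_cast; linear_combination -hc)
  have hd : d = 2 * c := by
    have := Int.cast_eq_zero.1 h0
    omega
  subst hd
  refine ⟨-c, ?_⟩
  push_cast
  have : (c : ℂ) + 2 * c * ω = c * θ := by rw [theta_eq]; ring
  rw [this]
  linear_combination (c : ℂ) * theta_sq

lemma exists_sign_sub_mem_thetaEis {z : ℂ} (hz : z ∈ Eis) :
    ∃ ε ∈ Eis, conj ε = ε ∧ (ε = 0 ∨ ε * ε = 1) ∧ z - ε ∈ thetaEis := by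
  obtain ⟨a, ha⟩ := exists_int_sub_mem_thetaEis hz
  have key : ∀ e : ℤ, (3 : ℤ) ∣ a - e → z - (e : ℂ) ∈ thetaEis := fun e he => by
    have := add_mem ha (intCast_mem_thetaEis_of_dvd he)
    push_cast at this
    simpa using this
  have h3 : (3 : ℤ) ∣ a - 0 ∨ (3 : ℤ) ∣ a - 1 ∨ (3 : ℤ) ∣ a - (-1) := by omega
  rcases h3 with h | h | h
  · exact ⟨0, zero_mem _, by simp, by simp, by simpa using key _ h⟩
  · exact ⟨1, one_mem _, by simp, by simp, by simpa using key _ h⟩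
  · exact ⟨-1, neg_mem (one_mem _), by simp, by simp, by simpa using key _ h⟩

lemma exists_unit_sub_two_mul {z : ℂ} (hz : z ∈ Eis) :
    ∃ ρ ∈ Eis, (ρ = 0 ∨ ρ * conj ρ = 1) ∧ ∃ x ∈ Eis, z = ρ + 2 * x := by
  obtain ⟨a, b, rfl⟩ := mem_Eis_iff.1 hz
  rcases Int.even_or_odd' a with ⟨c, rfl | rfl⟩ <;> rcases Int.even_or_odd' b with ⟨d, rfl | rfl⟩
  · exact ⟨0, zero_mem _, by simp, c + d * ω, mem_Eis_iff.2 ⟨c, d, rfl⟩, by push_cast; ring⟩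
  · refine ⟨ω, omega_mem, Or.inr ?_, c + d * ω, mem_Eis_iff.2 ⟨c, d, rfl⟩, by push_cast; ring⟩
    rw [conj_omega]; linear_combination -omega_sq
  · exact ⟨1, one_mem _, by simp, c + d * ω, mem_Eis_iff.2 ⟨c, d, rfl⟩, by push_cast; ring⟩
  · refine ⟨1 + ω, add_mem (one_mem _) omega_mem, Or.inr ?_, c + d * ω,
      mem_Eis_iff.2 ⟨c, d, rfl⟩, by push_cast; ring⟩
    rw [map_add, map_one, conj_omega]; linear_combination -omega_sq

lemma mem_thetaEis_of_two_mul {z : ℂ} (hz : z ∈ Eis) (h : 2 * z ∈ thetaEis) : z ∈ thetaEis := by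
  have := sub_mem (three_mul_mem_thetaEis hz) h
  rwa [show 3 * z - 2 * z = z by ring] at this

/-! ### The Hermitian form -/

section Herm

variable {n : ℕ}

lemma hermF_add_left (x y z : Fin n → ℂ) : hermF (x + y) z = hermF x z + hermF y z := by
  simp [hermF, add_mul, Finset.sum_add_distrib]

lemma hermF_smul_left (c : ℂ) (x z : Fin n → ℂ) : hermF (c • x) z = c * hermF x z := by
  simp [hermF, Finset.mul_sum, mul_assoc]

lemma hermF_conj (x y : Fin n → ℂ) : conj (hermF x y) = hermF y x := by
  simp [hermF, mul_comm]

lemma hermF_add_right (x y z : Fin n → ℂ) : hermF x (y + z) = hermF x y + hermF x z := by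
  simp [hermF, mul_add, Finset.sum_add_distrib]

lemma hermF_smul_right (c : ℂ) (x z : Fin n → ℂ) : hermF x (c • z) = conj c * hermF x z := by
  simp only [hermF, Finset.mul_sum, Pi.smul_apply, smul_eq_mul, map_mul]
  exact Finset.sum_congr rfl fun i _ => by ring

lemma hermF_zero_left (z : Fin n → ℂ) : hermF 0 z = 0 := by simp [hermF]

lemma hermF_neg_left (x z : Fin n → ℂ) : hermF (-x) z = -hermF x z := by
  simp [hermF]

lemma hermF_neg_right (x z : Fin n → ℂ) : hermF z (-x) = -hermF z x := by
  simp [hermF]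

lemma hermF_sub_left (x y z : Fin n → ℂ) : hermF (x - y) z = hermF x z - hermF y z := by
  rw [sub_eq_add_neg, hermF_add_left, hermF_neg_left, sub_eq_add_neg]

lemma hermF_sub_right (x y z : Fin n → ℂ) : hermF x (y - z) = hermF x y - hermF x z := by
  rw [sub_eq_add_neg, hermF_add_right, hermF_neg_right, sub_eq_add_neg]

lemma hermF_symm_zero {x y : Fin n → ℂ} (h : hermF x y = 0) : hermF y x = 0 := by
  rw [← hermF_conj, h, map_zero]

lemma hermF_sum_left {ι : Type*} (s : Finset ι) (f : ι → Fin n → ℂ) (z : Fin n → ℂ) :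
    hermF (∑ i ∈ s, f i) z = ∑ i ∈ s, hermF (f i) z := by
  classical
  induction s using Finset.induction_on with
  | empty => simp [hermF_zero_left]
  | insert a s ha ih => rw [Finset.sum_insert ha, Finset.sum_insert ha, hermF_add_left, ih]

lemma exists_hermF_self (x : Fin n → ℂ) : ∃ t : ℝ, 0 ≤ t ∧ hermF x x = t :=
  ⟨∑ i, Complex.normSq (x i), Finset.sum_nonneg fun _ _ => Complex.normSq_nonneg _, by
    simp [hermF, Complex.mul_conj]⟩

lemma hermF_self_eq_zero {x : Fin n → ℂ} : hermF x x = 0 ↔ x = 0 := by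
  refine ⟨fun h => ?_, fun h => by rw [h, hermF_zero_left]⟩
  have h' : ∑ i, Complex.normSq (x i) = 0 := by
    have : ((∑ i, Complex.normSq (x i) : ℝ) : ℂ) = 0 := by
      rw [← h]; simp [hermF, Complex.mul_conj]
    exact_mod_cast this
  rw [Finset.sum_eq_zero_iff_of_nonneg fun _ _ => Complex.normSq_nonneg _] at h'
  ext i
  exact Complex.normSq_eq_zero.1 (h' i (Finset.mem_univ i))

/-- `hermF` as a linear functional of its left argument. -/
def hermLeft (z : Fin n → ℂ) : (Fin n → ℂ) →ₗ[ℂ] ℂ where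
  toFun x := hermF x z
  map_add' x y := hermF_add_left x y z
  map_smul' c x := hermF_smul_left c x z

@[simp] lemma hermLeft_apply (x z : Fin n → ℂ) : hermLeft z x = hermF x z := rfl

end Herm

/-! ### Lattices with form values in `θ·Eis` -/

section Lattice

variable {n : ℕ}

/-- The form takes values in `θ·Eis` on `L`. -/
def ThetaIntegral (L : Submodule Eis (Fin n → ℂ)) : Prop :=
  ∀ x ∈ L, ∀ y ∈ L, hermF x y ∈ thetaEis

lemma ThetaIntegral.exists_hermF_self {L : Submodule Eis (Fin n → ℂ)} (hL : ThetaIntegral L)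
    {x : Fin n → ℂ} (hx : x ∈ L) : ∃ k : ℤ, hermF x x = 3 * k :=
  exists_eq_three_mul_of_conj_eq (hL x hx x hx) (hermF_conj x x)

/-- Every root of `L` lies in `M` or is orthogonal to `M`. -/
def RootSplits (L M : Submodule Eis (Fin n → ℂ)) : Prop :=
  ∀ s ∈ L, hermF s s = 3 → s ∈ M ∨ ∀ x ∈ M, hermF x s = 0

variable {L : Submodule Eis (Fin n → ℂ)}

lemma eq_zero_or_eq_zero_of_root (hL : ThetaIntegral L) {m w : Fin n → ℂ}
    (hw : w ∈ L) (hs : hermF (m + w) (m + w) = 3) (hwm : hermF w m = 0) :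
    m = 0 ∨ w = 0 := by
  obtain ⟨k, hk⟩ := hL.exists_hermF_self hw
  obtain ⟨t, ht, htm⟩ := exists_hermF_self m
  obtain ⟨u, hu, huw⟩ := exists_hermF_self w
  simp only [hermF_add_left, hermF_add_right, hwm, hermF_symm_zero hwm, huw, htm] at hs
  have hs' : t + u = 3 := by
    have : ((t + u : ℝ) : ℂ) = (3 : ℝ) := by push_cast; linear_combination hs
    exact_mod_cast this
  have hk' : u = 3 * k := by
    rw [huw] at hk; exact_mod_cast hk
  have h0 : (0 : ℤ) ≤ k := by
    have : (0 : ℝ) ≤ k := by linarith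
    exact_mod_cast this
  have h1 : k ≤ 1 := by
    have : (k : ℝ) ≤ 1 := by linarith
    exact_mod_cast this
  obtain rfl | rfl : k = 0 ∨ k = 1 := by omega
  · right
    rw [← hermF_self_eq_zero, huw, hk']; simp
  · left
    rw [← hermF_self_eq_zero, htm, show t = 0 by push_cast at hk'; linarith]; simp

lemma hermF_complement_of_root (hL : ThetaIntegral L) {m ρ w : Fin n → ℂ} {t : ℝ}
    (hρw : ρ + w ∈ L) (hs : hermF (m + ρ + w) (m + ρ + w) = 3)
    (hwm : hermF w m = 0) (hwρ : hermF w ρ = 0) (hρ : hermF ρ ρ = t) (ht0 : 0 < t)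
    (ht3 : t < 3) : hermF w w = ((3 - t : ℝ) : ℂ) := by
  obtain ⟨k, hk⟩ := hL.exists_hermF_self hρw
  obtain ⟨v, hv, hvm⟩ := exists_hermF_self (m + ρ)
  obtain ⟨u, hu, huw⟩ := exists_hermF_self w
  have hwp : hermF w (m + ρ) = 0 := by rw [hermF_add_right, hwm, hwρ, add_zero]
  rw [hermF_add_left (m + ρ), hermF_add_right (m + ρ), hermF_add_right w, hwp, hermF_symm_zero hwp, huw, hvm] at hs
  simp only [hermF_add_left, hermF_add_right, hwρ, hermF_symm_zero hwρ, huw, hρ] at hk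
  have hs' : v + u = 3 := by
    have : ((v + u : ℝ) : ℂ) = (3 : ℝ) := by push_cast; linear_combination hs
    exact_mod_cast this
  have hk' : t + u = 3 * k := by
    have : ((t + u : ℝ) : ℂ) = ((3 * k : ℝ) : ℂ) := by push_cast; linear_combination hk
    exact_mod_cast this
  have h0 : (0 : ℤ) < k := by
    have : (0 : ℝ) < k := by linarith
    exact_mod_cast this
  have h1 : k < 2 := by
    have : (k : ℝ) < 2 := by linarith
    exact_mod_cast this
  obtain rfl : k = 1 := by omega
  rw [huw, show u = 3 - t by push_cast at hk'; linarith]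

/-! ### Frames for the four lattices -/

/-- The lattice `θ·Eis·b`. -/
def A2Of (b : Fin n → ℂ) : Submodule Eis (Fin n → ℂ) where
  carrier := {v | ∃ x ∈ thetaEis, v = x • b}
  zero_mem' := ⟨0, zero_mem _, by simp⟩
  add_mem' := by
    rintro _ _ ⟨x, hx, rfl⟩ ⟨x', hx', rfl⟩
    exact ⟨x + x', add_mem hx hx', by module⟩
  smul_mem' := by
    rintro ⟨c, hc⟩ _ ⟨x, hx, rfl⟩
    exact ⟨c * x, mul_mem_thetaEis hc hx, by rw [Subring.smul_def, smul_smul]⟩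

/-- The lattice of all `x·a + y·b` with `x ≡ y` modulo `θ`. -/
def D4Of (a b : Fin n → ℂ) : Submodule Eis (Fin n → ℂ) where
  carrier := {v | ∃ x ∈ Eis, ∃ y ∈ Eis, x - y ∈ thetaEis ∧ v = x • a + y • b}
  zero_mem' := ⟨0, zero_mem _, 0, zero_mem _, by simp, by simp⟩
  add_mem' := by
    rintro _ _ ⟨x, hx, y, hy, h, rfl⟩ ⟨x', hx', y', hy', h', rfl⟩
    refine ⟨x + x', add_mem hx hx', y + y', add_mem hy hy', ?_, by module⟩
    rw [add_sub_add_comm]; exact add_mem h h'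
  smul_mem' := by
    rintro ⟨c, hc⟩ _ ⟨x, hx, y, hy, h, rfl⟩
    refine ⟨c * x, mul_mem hc hx, c * y, mul_mem hc hy, ?_, by rw [Subring.smul_def]; module⟩
    rw [← mul_sub]; exact mul_mem_thetaEis hc h

/-- The lattice of all `x·a + y·b + z·c` with `x ≡ y ≡ z` modulo `θ`. -/
def E6Of (a b c : Fin n → ℂ) : Submodule Eis (Fin n → ℂ) where
  carrier := {v | ∃ x ∈ Eis, ∃ y ∈ Eis, ∃ z ∈ Eis, x - y ∈ thetaEis ∧ y - z ∈ thetaEis ∧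
    v = x • a + y • b + z • c}
  zero_mem' := ⟨0, zero_mem _, 0, zero_mem _, 0, zero_mem _, by simp, by simp, by simp⟩
  add_mem' := by
    rintro _ _ ⟨x, hx, y, hy, z, hz, h, k, rfl⟩ ⟨x', hx', y', hy', z', hz', h', k', rfl⟩
    refine ⟨x + x', add_mem hx hx', y + y', add_mem hy hy', z + z', add_mem hz hz', ?_, ?_,
      by module⟩
    · rw [add_sub_add_comm]; exact add_mem h h'
    · rw [add_sub_add_comm]; exact add_mem k k'
  smul_mem' := by
    rintro ⟨e, he⟩ _ ⟨x, hx, y, hy, z, hz, h, k, rfl⟩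
    refine ⟨e * x, mul_mem he hx, e * y, mul_mem he hy, e * z, mul_mem he hz, ?_, ?_,
      by rw [Subring.smul_def]; module⟩
    · rw [← mul_sub]; exact mul_mem_thetaEis he h
    · rw [← mul_sub]; exact mul_mem_thetaEis he k

/-- The lattice of all `t·d + x·a + y·b + z·c` with `x + y + z ≡ t + y - z ≡ 0` modulo `θ`. -/
def E8Of (d a b c : Fin n → ℂ) : Submodule Eis (Fin n → ℂ) where
  carrier := {v | ∃ t ∈ Eis, ∃ x ∈ Eis, ∃ y ∈ Eis, ∃ z ∈ Eis,
    x + y + z ∈ thetaEis ∧ t + y - z ∈ thetaEis ∧ v = t • d + x • a + y • b + z • c}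
  zero_mem' := ⟨0, zero_mem _, 0, zero_mem _, 0, zero_mem _, 0, zero_mem _,
    by simp, by simp, by simp⟩
  add_mem' := by
    rintro _ _ ⟨t, ht, x, hx, y, hy, z, hz, h, k, rfl⟩
      ⟨t', ht', x', hx', y', hy', z', hz', h', k', rfl⟩
    refine ⟨t + t', add_mem ht ht', x + x', add_mem hx hx', y + y', add_mem hy hy',
      z + z', add_mem hz hz', ?_, ?_, by module⟩
    · convert add_mem h h' using 1; ring
    · convert add_mem k k' using 1; ring
  smul_mem' := by
    rintro ⟨e, he⟩ _ ⟨t, ht, x, hx, y, hy, z, hz, h, k, rfl⟩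
    refine ⟨e * t, mul_mem he ht, e * x, mul_mem he hx, e * y, mul_mem he hy,
      e * z, mul_mem he hz, ?_, ?_, by rw [Subring.smul_def]; module⟩
    · convert mul_mem_thetaEis he h using 1; ring
    · convert mul_mem_thetaEis he k using 1; ring

lemma theta_smul_mem_A2Of (b : Fin n → ℂ) : θ • b ∈ A2Of b :=
  ⟨θ, theta_mem_thetaEis, rfl⟩

lemma theta_smul_mem_D4Of (a b : Fin n → ℂ) : θ • b ∈ D4Of a b :=
  ⟨0, zero_mem _, θ, theta_mem, by simpa using theta_mem_thetaEis, by simp⟩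

lemma theta_smul_mem_E6Of (a b c : Fin n → ℂ) : θ • c ∈ E6Of a b c :=
  ⟨0, zero_mem _, 0, zero_mem _, θ, theta_mem, by simp, by simpa using theta_mem_thetaEis,
    by simp⟩

lemma theta_smul_mem_E8Of (d a b c : Fin n → ℂ) : θ • c ∈ E8Of d a b c :=
  ⟨0, zero_mem _, 0, zero_mem _, 0, zero_mem _, θ, theta_mem,
    by simpa using theta_mem_thetaEis, by simpa using theta_mem_thetaEis, by simp⟩

lemma theta_smul_ne_zero {b : Fin n → ℂ} (hb : hermF b b = 1) : θ • b ≠ 0 := by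
  refine smul_ne_zero theta_ne_zero fun h => ?_
  rw [h, hermF_zero_left] at hb
  exact zero_ne_one hb

/-- If `θ·b` lies in a `θ`-integral lattice, the `b`-coordinate of each element is integral. -/
lemma hermF_mem_Eis (hL : ThetaIntegral L) {s b : Fin n → ℂ} (hs : s ∈ L) (hb : θ • b ∈ L) :
    hermF s b ∈ Eis :=
  mem_Eis_of_conj_theta_mul (hermF_smul_right θ s b ▸ hL s hs _ hb)

/-! ### Extending a component by a root -/

lemma A2Of_splits_or_extends (hL : ThetaIntegral L) {b : Fin n → ℂ} (hb : hermF b b = 1)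
    (hM : A2Of b ≤ L) :
    RootSplits L (A2Of b) ∨
      ∃ a, hermF a a = 2 ∧ hermF a b = 0 ∧ D4Of a b ≤ L := by
  refine or_iff_not_imp_right.2 fun hno s hs hs3 => ?_
  set β := hermF s b with hβ
  have hβE : β ∈ Eis := hermF_mem_Eis hL hs (hM (theta_smul_mem_A2Of b))
  obtain ⟨ε, hεE, hεc, hε, hβε⟩ := exists_sign_sub_mem_thetaEis hβE
  set m : Fin n → ℂ := (β - ε) • b with hm
  have hmM : m ∈ A2Of b := ⟨_, hβε, rfl⟩
  set w : Fin n → ℂ := s - β • b with hw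
  have hwb : hermF w b = 0 := by
    rw [hw, hermF_sub_left, hermF_smul_left, hb, ← hβ]; ring
  have hsm : s - m ∈ L := sub_mem hs (hM hmM)
  rcases hε with rfl | hε
  · have hsw : s = m + w := by rw [hm, hw]; module
    have hwL : w ∈ L := by rwa [hsw, add_sub_cancel_left] at hsm
    rcases eq_zero_or_eq_zero_of_root hL hwL (hsw ▸ hs3)
      (by rw [hm, hermF_smul_right, hwb, mul_zero]) with h | h
    · right
      rintro _ ⟨x, -, rfl⟩
      rw [hsw, h, zero_add, hermF_smul_left, hermF_symm_zero hwb, mul_zero]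
    · left
      rwa [hsw, h, add_zero]
  · refine absurd ⟨ε • w, ?_, ?_, ?_⟩ hno
    · have hsw : s = m + ε • b + w := by rw [hm, hw]; module
      have hww := hermF_complement_of_root (t := 1) hL (m := m) (ρ := ε • b) (w := w)
        (by rwa [hsw, add_assoc, add_sub_cancel_left] at hsm) (hsw ▸ hs3)
        (by rw [hm, hermF_smul_right, hwb, mul_zero]) (by rw [hermF_smul_right, hwb, mul_zero])
        (by rw [hermF_smul_left, hermF_smul_right, hb, hεc]; simpa using hε)
        (by norm_num) (by norm_num)
      rw [hermF_smul_left, hermF_smul_right, hww, hεc, ← mul_assoc, hε]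
      norm_num
    · rw [hermF_smul_left, hwb, mul_zero]
    · rintro _ ⟨x, hx, y, hy, hxy, rfl⟩
      have : x • ε • w + y • b = (x * ε) • (s - m) + (-(x - y)) • b := by
        have hwm : w = (s - m) - ε • b := by rw [hm, hw]; module
        rw [hwm, smul_sub, smul_smul ε ε, hε]; module
      rw [this]
      exact add_mem (smul_mem_of_mem_Eis L (mul_mem hx hεE) hsm) (hM ⟨_, neg_mem hxy, rfl⟩)

lemma D4Of_splits_or_extends (hL : ThetaIntegral L) {a b : Fin n → ℂ} (ha : hermF a a = 2)
    (hb : hermF b b = 1) (hab : hermF a b = 0) (hM : D4Of a b ≤ L) :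
    RootSplits L (D4Of a b) ∨
      ∃ e₁ e₂, hermF e₁ e₁ = 1 ∧ hermF e₂ e₂ = 1 ∧ hermF e₁ e₂ = 0 ∧ hermF e₁ b = 0 ∧
        hermF e₂ b = 0 ∧ E6Of e₁ e₂ b ≤ L := by
  refine or_iff_not_imp_right.2 fun hno s hs hs3 => ?_
  have hba := hermF_symm_zero hab
  set α := hermF s a with hα
  set β := hermF s b with hβ
  have hαE : α ∈ Eis := hermF_mem_Eis hL hs
    (hM ⟨θ, theta_mem, 0, zero_mem _, by simpa using theta_mem_thetaEis, by simp⟩)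
  have hβE : β ∈ Eis := hermF_mem_Eis hL hs (hM (theta_smul_mem_D4Of a b))
  have hαβ : α + β ∈ thetaEis := by
    rw [hα, hβ, ← hermF_add_right]
    exact hL s hs _ (hM ⟨1, one_mem _, 1, one_mem _, by simp, by simp⟩)
  obtain ⟨ρ, hρE, hρ, x₀, hx₀, hαρ⟩ := exists_unit_sub_two_mul hαE
  set x := x₀ - ρ * ω with hx
  have hxE : x ∈ Eis := sub_mem hx₀ (mul_mem hρE omega_mem)
  have hαx : α = ρ * θ + 2 * x := by rw [hαρ, hx, theta_eq]; ring
  have hxβ : x - β ∈ thetaEis := by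
    refine mem_thetaEis_of_two_mul (sub_mem hxE hβE) ?_
    have := sub_mem (sub_mem hαβ (theta_mul_mem hρE)) (three_mul_mem_thetaEis hβE)
    convert this using 1
    rw [hαx]; ring
  set m : Fin n → ℂ := x • a + β • b with hm
  have hmM : m ∈ D4Of a b := ⟨x, hxE, β, hβE, hxβ, rfl⟩
  set w : Fin n → ℂ := s - (α / 2) • a - β • b with hw
  have hwa : hermF w a = 0 := by
    rw [hw, hermF_sub_left, hermF_sub_left, hermF_smul_left, hermF_smul_left, ha, hba, ← hα]; ring
  have hwb : hermF w b = 0 := by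
    rw [hw, hermF_sub_left, hermF_sub_left, hermF_smul_left, hermF_smul_left, hb, hab, ← hβ]; ring
  have haw := hermF_symm_zero hwa
  have hbw := hermF_symm_zero hwb
  have hwm : hermF w m = 0 := by
    rw [hm, hermF_add_right, hermF_smul_right, hermF_smul_right, hwa, hwb]; ring
  have hsm : s - m ∈ L := sub_mem hs (hM hmM)
  have hsw : s = m + (ρ * θ / 2) • a + w := by
    rw [hm, hw, hαx]; module
  rcases hρ with rfl | hρ
  · replace hsw : s = m + w := by simpa using hsw
    have hwL : w ∈ L := by rwa [hsw, add_sub_cancel_left] at hsm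
    rcases eq_zero_or_eq_zero_of_root hL hwL (hsw ▸ hs3) hwm with h | h
    · right
      rintro _ ⟨x, -, y, -, -, rfl⟩
      rw [hsw, h, zero_add, hermF_add_left, hermF_smul_left, hermF_smul_left, haw, hbw]; ring
    · left
      rwa [hsw, h, add_zero]
  · have hww := hermF_complement_of_root (t := 3 / 2) hL (m := m) (ρ := (ρ * θ / 2) • a) (w := w)
      (by rwa [hsw, add_assoc, add_sub_cancel_left] at hsm) (hsw ▸ hs3) hwm
      (by rw [hermF_smul_right, hwa, mul_zero])
      (by
        rw [hermF_smul_left, hermF_smul_right, ha, map_div₀, map_mul, conj_theta, map_ofNat]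
        push_cast
        linear_combination (3 / 2 : ℂ) * hρ - ρ * conj ρ / 2 * theta_sq)
      (by norm_num) (by norm_num)
    replace hww : hermF w w = 3 / 2 := by rw [hww]; push_cast; norm_num
    set μ : ℂ := -(θ / 3) * conj ρ with hμ
    have hμμ : μ * conj μ = 1 / 3 := by
      rw [hμ, map_mul, map_neg, map_div₀, conj_theta, Complex.conj_conj, map_ofNat]
      linear_combination (1 / 3 : ℂ) * hρ - ρ * conj ρ / 9 * theta_sq
    have hμθ : θ * μ = conj ρ := by
      rw [hμ]; linear_combination -conj ρ / 3 * theta_sq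
    clear_value m w μ
    refine absurd ⟨(1 / 2 : ℂ) • a + μ • w, (1 / 2 : ℂ) • a - μ • w, ?_, ?_, ?_, ?_, ?_, ?_⟩ hno
    · simp only [hermF_add_left, hermF_add_right, hermF_smul_left, hermF_smul_right, ha, hwa, haw,
        hww, map_div₀, map_one, map_ofNat]
      linear_combination (3 / 2 : ℂ) * hμμ
    · simp only [hermF_sub_left, hermF_sub_right, hermF_smul_left, hermF_smul_right, ha, hwa, haw,
        hww, map_div₀, map_one, map_ofNat]
      linear_combination (3 / 2 : ℂ) * hμμ
    · simp only [hermF_add_left, hermF_sub_right, hermF_smul_left, hermF_smul_right, ha, hwa, haw,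
        hww, map_div₀, map_one, map_ofNat]
      linear_combination (-3 / 2 : ℂ) * hμμ
    · simp only [hermF_add_left, hermF_smul_left, hab, hwb]; ring
    · simp only [hermF_sub_left, hermF_smul_left, hab, hwb]; ring
    · rintro _ ⟨x', hx', y, hy, z, hz, ⟨e, he, hxy⟩, hyz, rfl⟩
      have : x' • ((1 / 2 : ℂ) • a + μ • w) + y • ((1 / 2 : ℂ) • a - μ • w) + z • b
          = (e * conj ρ) • (s - m) + (y • a + z • b) := by
        have hsm' : s - m = (ρ * θ / 2) • a + w := by rw [hsw]; module
        rw [hsm', eq_add_of_sub_eq hxy]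
        match_scalars
        · linear_combination (-e * θ / 2) * hρ
        · linear_combination e * hμθ
        · ring
      rw [this]
      exact add_mem (smul_mem_of_mem_Eis L (mul_mem he (conj_mem_Eis hρE)) hsm)
        (hM ⟨y, hy, z, hz, hyz, rfl⟩)

lemma E6Of_splits_or_extends (hL : ThetaIntegral L) {a b c : Fin n → ℂ} (ha : hermF a a = 1)
    (hb : hermF b b = 1) (hc : hermF c c = 1) (hab : hermF a b = 0) (hac : hermF a c = 0)
    (hbc : hermF b c = 0) (hM : E6Of a b c ≤ L) :
    RootSplits L (E6Of a b c) ∨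
      ∃ d, hermF d d = 1 ∧ hermF d a = 0 ∧ hermF d b = 0 ∧ hermF d c = 0 ∧
        E8Of d a b c ≤ L := by
  refine or_iff_not_imp_right.2 fun hno s hs hs3 => ?_
  have hba := hermF_symm_zero hab
  have hca := hermF_symm_zero hac
  have hcb := hermF_symm_zero hbc
  set α := hermF s a with hα
  set β := hermF s b with hβ
  set γ := hermF s c with hγ
  have hαE : α ∈ Eis := hermF_mem_Eis hL hs
    (hM ⟨θ, theta_mem, 0, zero_mem _, 0, zero_mem _, by simpa using theta_mem_thetaEis, by simp,
      by simp⟩)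
  have hβE : β ∈ Eis := hermF_mem_Eis hL hs
    (hM ⟨0, zero_mem _, θ, theta_mem, 0, zero_mem _, by simpa using theta_mem_thetaEis,
      by simpa using theta_mem_thetaEis, by simp⟩)
  have hγE : γ ∈ Eis := hermF_mem_Eis hL hs (hM (theta_smul_mem_E6Of a b c))
  have hαβγ : α + β + γ ∈ thetaEis := by
    rw [hα, hβ, hγ, ← hermF_add_right, ← hermF_add_right]
    exact hL s hs _ (hM ⟨1, one_mem _, 1, one_mem _, 1, one_mem _, by simp, by simp, by simp⟩)
  obtain ⟨ε, hεE, hεc, hε, hβε⟩ := exists_sign_sub_mem_thetaEis (sub_mem hβE hαE)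
  set m : Fin n → ℂ := α • a + (β - ε) • b + (γ + ε) • c with hm
  have hmM : m ∈ E6Of a b c := by
    refine ⟨α, hαE, β - ε, sub_mem hβE hεE, γ + ε, add_mem hγE hεE, ?_, ?_, rfl⟩
    · convert neg_mem hβε using 1; ring
    · convert add_mem (sub_mem (add_mem hβε hβε) hαβγ) (three_mul_mem_thetaEis hαE) using 1; ring
  set w : Fin n → ℂ := s - α • a - β • b - γ • c with hw
  have hwa : hermF w a = 0 := by
    simp only [hw, hermF_sub_left, hermF_smul_left, ha, hba, hca, ← hα]; ring
  have hwb : hermF w b = 0 := by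
    simp only [hw, hermF_sub_left, hermF_smul_left, hb, hab, hcb, ← hβ]; ring
  have hwc : hermF w c = 0 := by
    simp only [hw, hermF_sub_left, hermF_smul_left, hc, hac, hbc, ← hγ]; ring
  have hwm : hermF w m = 0 := by
    simp only [hm, hermF_add_right, hermF_smul_right, hwa, hwb, hwc]; ring
  have hsm : s - m ∈ L := sub_mem hs (hM hmM)
  have hsw : s = m + (ε • b - ε • c) + w := by rw [hm, hw]; module
  rcases hε with rfl | hε
  · replace hsw : s = m + w := by simpa using hsw
    have hwL : w ∈ L := by rwa [hsw, add_sub_cancel_left] at hsm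
    rcases eq_zero_or_eq_zero_of_root hL hwL (hsw ▸ hs3) hwm with h | h
    · right
      rintro _ ⟨x, -, y, -, z, -, -, -, rfl⟩
      simp only [hsw, h, zero_add, hermF_add_left, hermF_smul_left, hermF_symm_zero hwa,
        hermF_symm_zero hwb, hermF_symm_zero hwc, mul_zero]
    · left
      rwa [hsw, h, add_zero]
  · have hww := hermF_complement_of_root (t := 2) hL (m := m) (ρ := ε • b - ε • c) (w := w)
      (by rwa [hsw, add_assoc, add_sub_cancel_left] at hsm) (hsw ▸ hs3) hwm
      (by simp only [hermF_sub_right, hermF_smul_right, hwb, hwc]; ring)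
      (by
        simp only [hermF_sub_left, hermF_sub_right, hermF_smul_left, hermF_smul_right, hb, hc, hbc,
          hcb, hεc]
        push_cast
        linear_combination 2 * hε)
      (by norm_num) (by norm_num)
    refine absurd ⟨ε • w, ?_, ?_, ?_, ?_, ?_⟩ hno
    · rw [hermF_smul_left, hermF_smul_right, hww, hεc, ← mul_assoc, hε]
      norm_num
    · rw [hermF_smul_left, hwa, mul_zero]
    · rw [hermF_smul_left, hwb, mul_zero]
    · rw [hermF_smul_left, hwc, mul_zero]
    · rintro _ ⟨t, ht, x, hx, y, hy, z, hz, hxyz, htyz, rfl⟩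
      have : t • ε • w + x • a + y • b + z • c
          = (t * ε) • (s - m) + (x • a + (y - t) • b + (z + t) • c) := by
        have hsm' : s - m = (ε • b - ε • c) + w := by rw [hsw]; module
        rw [hsm']
        match_scalars
        · ring
        · ring
        · linear_combination -t * hε
        · linear_combination t * hε
      rw [this]
      refine add_mem (smul_mem_of_mem_Eis L (mul_mem ht hεE) hsm)
        (hM ⟨x, hx, y - t, sub_mem hy ht, z + t, add_mem hz ht, ?_, ?_, rfl⟩)
      · convert sub_mem (add_mem hxyz htyz) (three_mul_mem_thetaEis hy) using 1; ring
      · convert sub_mem htyz (three_mul_mem_thetaEis ht) using 1; ring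

lemma E8Of_splits (hL : ThetaIntegral L) {d a b c : Fin n → ℂ} (hd : hermF d d = 1)
    (ha : hermF a a = 1) (hb : hermF b b = 1) (hc : hermF c c = 1) (hda : hermF d a = 0)
    (hdb : hermF d b = 0) (hdc : hermF d c = 0) (hab : hermF a b = 0) (hac : hermF a c = 0)
    (hbc : hermF b c = 0) (hM : E8Of d a b c ≤ L) : RootSplits L (E8Of d a b c) := by
  intro s hs hs3
  have hT := theta_mem_thetaEis
  have hδE : hermF s d ∈ Eis := hermF_mem_Eis hL hs
    (hM ⟨θ, theta_mem, 0, zero_mem _, 0, zero_mem _, 0, zero_mem _, by simp, by simpa using hT,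
      by simp⟩)
  have hαE : hermF s a ∈ Eis := hermF_mem_Eis hL hs
    (hM ⟨0, zero_mem _, θ, theta_mem, 0, zero_mem _, 0, zero_mem _, by simpa using hT, by simp,
      by simp⟩)
  have hβE : hermF s b ∈ Eis := hermF_mem_Eis hL hs
    (hM ⟨0, zero_mem _, 0, zero_mem _, θ, theta_mem, 0, zero_mem _, by simpa using hT,
      by simpa using hT, by simp⟩)
  have hγE : hermF s c ∈ Eis := hermF_mem_Eis hL hs (hM (theta_smul_mem_E8Of d a b c))
  have h₁ : hermF s a + hermF s b + hermF s c ∈ thetaEis := by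
    rw [← hermF_add_right, ← hermF_add_right]
    exact hL s hs _ (hM ⟨0, zero_mem _, 1, one_mem _, 1, one_mem _, 1, one_mem _,
      by convert three_mul_mem_thetaEis (one_mem _) using 1; ring, by simp, by simp⟩)
  have h₂ : hermF s d + hermF s b - hermF s c ∈ thetaEis := by
    rw [← hermF_add_right, ← hermF_sub_right]
    exact hL s hs _ (hM ⟨1, one_mem _, 0, zero_mem _, 1, one_mem _, -1, neg_mem (one_mem _),
      by simp, by convert three_mul_mem_thetaEis (one_mem _) using 1; ring, by module⟩)
  set m : Fin n → ℂ := hermF s d • d + hermF s a • a + hermF s b • b + hermF s c • c with hm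
  have hmM : m ∈ E8Of d a b c := ⟨_, hδE, _, hαE, _, hβE, _, hγE, h₁, h₂, rfl⟩
  have hwL : s - m ∈ L := sub_mem hs (hM hmM)
  have hwd : hermF (s - m) d = 0 := by
    simp only [hm, hermF_sub_left, hermF_add_left, hermF_smul_left, hd, hermF_symm_zero hda,
      hermF_symm_zero hdb, hermF_symm_zero hdc]; ring
  have hwa : hermF (s - m) a = 0 := by
    simp only [hm, hermF_sub_left, hermF_add_left, hermF_smul_left, ha, hda,
      hermF_symm_zero hab, hermF_symm_zero hac]; ring
  have hwb : hermF (s - m) b = 0 := by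
    simp only [hm, hermF_sub_left, hermF_add_left, hermF_smul_left, hb, hdb, hab,
      hermF_symm_zero hbc]; ring
  have hwc : hermF (s - m) c = 0 := by
    simp only [hm, hermF_sub_left, hermF_add_left, hermF_smul_left, hc, hdc, hac, hbc]; ring
  have hperp : ∀ x ∈ E8Of d a b c, hermF x (s - m) = 0 := by
    rintro _ ⟨t, -, x, -, y, -, z, -, -, -, rfl⟩
    simp only [hermF_add_left, hermF_smul_left, hermF_symm_zero hwa, hermF_symm_zero hwb,
      hermF_symm_zero hwc, hermF_symm_zero hwd, mul_zero, add_zero]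
  rcases eq_zero_or_eq_zero_of_root hL hwL (m := m) (by simpa using hs3)
    (hermF_symm_zero (hperp m hmM)) with h | h
  · right
    simpa [h] using hperp
  · left
    rwa [sub_eq_zero.1 h]

/-! ### Coordinates -/

lemma latIsom_of_linear {k : ℕ} {M : Submodule Eis (Fin n → ℂ)} {Y : Set (Fin k → ℂ)}
    (f : (Fin n → ℂ) →ₗ[ℂ] (Fin k → ℂ)) (hmaps : Set.MapsTo f M Y) (hsurj : Set.SurjOn f M Y)
    (hiso : ∀ x ∈ M, ∀ y ∈ M, hermF (f x) (f y) = hermF x y) : LatIsom (M : Set (Fin n → ℂ)) Y := by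
  refine ⟨f, ⟨hmaps, fun x hx y hy hxy => ?_, hsurj⟩, fun x _ y _ => map_add f x y,
    fun x _ => map_smul f ω x, hiso⟩
  have h := hiso _ (sub_mem hx hy) _ (sub_mem hx hy)
  rw [map_sub, hxy, sub_self, hermF_zero_left] at h
  exact sub_eq_zero.1 (hermF_self_eq_zero.1 h.symm)

lemma latIsom_A2Of {b : Fin n → ℂ} (hb : hermF b b = 1) :
    LatIsom (A2Of b : Set (Fin n → ℂ)) A2L := by
  refine latIsom_of_linear (LinearMap.pi ![hermLeft b]) ?_ ?_ ?_
  · rintro _ ⟨x, hx, rfl⟩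
    simpa [A2L, hermF_smul_left, hb, mem_thetaEis] using hx
  · intro y hy
    refine ⟨y 0 • b, ⟨y 0, hy, rfl⟩, ?_⟩
    ext i
    fin_cases i
    simp [hb]
  · rintro _ ⟨x, hx, rfl⟩ _ ⟨y, hy, rfl⟩
    simp [hermF_smul_left, hermF_smul_right, hb, hermF.eq_def (k := 1), mul_comm]

lemma latIsom_D4Of {a b : Fin n → ℂ} (ha : hermF a a = 2) (hb : hermF b b = 1)
    (hab : hermF a b = 0) : LatIsom (D4Of a b : Set (Fin n → ℂ)) D4L := by
  have hba := hermF_symm_zero hab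
  have key : ∀ x y : ℂ, LinearMap.pi ![(1 / 2 : ℂ) • hermLeft a, (1 / 2 : ℂ) • hermLeft a,
      hermLeft b] (x • a + y • b) = ![x, x, y] := fun x y => by
    ext i
    fin_cases i <;> simp [hermF_add_left, hermF_smul_left, ha, hb, hab, hba, mul_comm]
  refine latIsom_of_linear (LinearMap.pi ![(1 / 2 : ℂ) • hermLeft a, (1 / 2 : ℂ) • hermLeft a,
    hermLeft b]) ?_ ?_ ?_
  · rintro _ ⟨x, hx, y, hy, hxy, rfl⟩
    rw [key]
    exact ⟨fun i => by fin_cases i <;> simpa, rfl, hxy⟩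
  · rintro y ⟨hy, h₁, h₂⟩
    refine ⟨y 0 • a + y 2 • b, ⟨y 0, hy 0, y 2, hy 2, h₂, rfl⟩, ?_⟩
    rw [key]
    ext i
    fin_cases i <;> simp [h₁]
  · rintro _ ⟨x, hx, y, hy, -, rfl⟩ _ ⟨x', hx', y', hy', -, rfl⟩
    rw [key, key]
    simp only [hermF_add_left, hermF_add_right, hermF_smul_left, hermF_smul_right, ha, hb, hab, hba]
    simp [hermF, Fin.sum_univ_three]
    ring

lemma latIsom_E6Of {a b c : Fin n → ℂ} (ha : hermF a a = 1) (hb : hermF b b = 1)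
    (hc : hermF c c = 1) (hab : hermF a b = 0) (hac : hermF a c = 0) (hbc : hermF b c = 0) :
    LatIsom (E6Of a b c : Set (Fin n → ℂ)) E6L := by
  have hba := hermF_symm_zero hab
  have hca := hermF_symm_zero hac
  have hcb := hermF_symm_zero hbc
  have key : ∀ x y z : ℂ, LinearMap.pi ![hermLeft a, hermLeft b, hermLeft c]
      (x • a + y • b + z • c) = ![x, y, z] := fun x y z => by
    ext i
    fin_cases i <;>
      simp [hermF_add_left, hermF_smul_left, ha, hb, hc, hab, hba, hac, hca, hbc, hcb]
  refine latIsom_of_linear (LinearMap.pi ![hermLeft a, hermLeft b, hermLeft c]) ?_ ?_ ?_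
  · rintro _ ⟨x, hx, y, hy, z, hz, hxy, hyz, rfl⟩
    rw [key]
    exact ⟨fun i => by fin_cases i <;> simpa, hxy, hyz⟩
  · rintro y ⟨hy, h₁, h₂⟩
    refine ⟨y 0 • a + y 1 • b + y 2 • c,
      ⟨y 0, hy 0, y 1, hy 1, y 2, hy 2, h₁, h₂, rfl⟩, ?_⟩
    rw [key]
    ext i
    fin_cases i <;> simp
  · rintro _ ⟨x, hx, y, hy, z, hz, -, -, rfl⟩ _ ⟨x', hx', y', hy', z', hz', -, -, rfl⟩
    rw [key, key]
    simp only [hermF_add_left, hermF_add_right, hermF_smul_left, hermF_smul_right, ha, hb, hc,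
      hab, hba, hac, hca, hbc, hcb]
    simp [hermF, Fin.sum_univ_three]
    ring

lemma three_dvd_iff {a : ℤ} : (3 : ℤ) ∣ a ↔ (a : ZMod 3) = 0 :=
  (ZMod.intCast_zmod_eq_zero_iff_dvd a 3).symm

lemma mem_tetracode_iff {c : Fin 4 → ZMod 3} :
    c ∈ tetracode ↔ c 1 + c 2 + c 3 = 0 ∧ c 0 + c 2 - c 3 = 0 := by
  rw [tetracode, Submodule.mem_span_pair]
  constructor
  · rintro ⟨p, q, rfl⟩
    simp
    revert p q
    decide
  · rintro ⟨h₁, h₂⟩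
    refine ⟨c 1, c 0, ?_⟩
    have h3 : (3 : ZMod 3) = 0 := rfl
    ext i
    fin_cases i
    · simp
    · simp
    · simp; linear_combination h₁ + h₂ - c 2 * h3
    · simp; linear_combination h₁ - h₂ - c 3 * h3

/-- The self-duality of the tetracode turns membership in `E₈^E` into two congruences. -/
lemma mem_E8L_iff {x : Fin 4 → ℂ} : x ∈ E8L ↔ (∀ i, x i ∈ Eis) ∧
    x 1 + x 2 + x 3 ∈ thetaEis ∧ x 0 + x 2 - x 3 ∈ thetaEis := by
  refine and_congr_right fun hx => ⟨?_, ?_⟩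
  · rintro ⟨c, hc, h⟩
    replace h : ∀ i, x i - ((c i).val : ℂ) ∈ thetaEis := h
    obtain ⟨h₁, h₂⟩ := mem_tetracode_iff.1 hc
    have d₁ : (3 : ℤ) ∣ (c 1).val + (c 2).val + (c 3).val := by
      rw [three_dvd_iff]; simpa using h₁
    have d₂ : (3 : ℤ) ∣ (c 0).val + (c 2).val - (c 3).val := by
      rw [three_dvd_iff]; simpa using h₂
    constructor
    · convert add_mem (add_mem (add_mem (h 1) (h 2)) (h 3)) (intCast_mem_thetaEis_of_dvd d₁) using 1
      push_cast; ring
    · convert add_mem (sub_mem (add_mem (h 0) (h 2)) (h 3)) (intCast_mem_thetaEis_of_dvd d₂) using 1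
      push_cast; ring
  · rintro ⟨h₁, h₂⟩
    choose a ha using fun i => exists_int_sub_mem_thetaEis (hx i)
    refine ⟨fun i => (a i : ZMod 3), mem_tetracode_iff.2 ⟨?_, ?_⟩, fun i => ?_⟩
    · have : (3 : ℤ) ∣ a 1 + a 2 + a 3 := dvd_of_intCast_mem_thetaEis (by
        convert sub_mem h₁ (add_mem (add_mem (ha 1) (ha 2)) (ha 3)) using 1
        push_cast; ring)
      rw [three_dvd_iff] at this
      simpa using this
    · have : (3 : ℤ) ∣ a 0 + a 2 - a 3 := dvd_of_intCast_mem_thetaEis (by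
        convert sub_mem h₂ (sub_mem (add_mem (ha 0) (ha 2)) (ha 3)) using 1
        push_cast; ring)
      rw [three_dvd_iff] at this
      simpa using this
    · have : (3 : ℤ) ∣ a i - ((a i : ZMod 3).val : ℤ) := by
        rw [three_dvd_iff]; simp
      have h := add_mem (ha i) (intCast_mem_thetaEis_of_dvd this)
      push_cast at h
      rwa [sub_add_sub_cancel] at h

lemma latIsom_E8Of {d a b c : Fin n → ℂ} (hd : hermF d d = 1) (ha : hermF a a = 1)
    (hb : hermF b b = 1) (hc : hermF c c = 1) (hda : hermF d a = 0) (hdb : hermF d b = 0)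
    (hdc : hermF d c = 0) (hab : hermF a b = 0) (hac : hermF a c = 0) (hbc : hermF b c = 0) :
    LatIsom (E8Of d a b c : Set (Fin n → ℂ)) E8L := by
  have had := hermF_symm_zero hda
  have hbd := hermF_symm_zero hdb
  have hcd := hermF_symm_zero hdc
  have hba := hermF_symm_zero hab
  have hca := hermF_symm_zero hac
  have hcb := hermF_symm_zero hbc
  have key : ∀ t x y z : ℂ, LinearMap.pi ![hermLeft d, hermLeft a, hermLeft b, hermLeft c]
      (t • d + x • a + y • b + z • c) = ![t, x, y, z] := fun t x y z => by
    ext i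
    fin_cases i <;>
      simp [hermF_add_left, hermF_smul_left, ha, hb, hc, hd, hab, hba, hac, hca, hbc, hcb, hda,
        had, hdb, hbd, hdc, hcd]
  refine latIsom_of_linear (LinearMap.pi ![hermLeft d, hermLeft a, hermLeft b, hermLeft c])
    ?_ ?_ ?_
  · rintro _ ⟨t, ht, x, hx, y, hy, z, hz, h₁, h₂, rfl⟩
    rw [key, mem_E8L_iff]
    exact ⟨fun i => by fin_cases i <;> simpa, h₁, h₂⟩
  · intro y h
    obtain ⟨hy, h₁, h₂⟩ := mem_E8L_iff.1 h
    refine ⟨y 0 • d + y 1 • a + y 2 • b + y 3 • c,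
      ⟨y 0, hy 0, y 1, hy 1, y 2, hy 2, y 3, hy 3, h₁, h₂, rfl⟩, ?_⟩
    rw [key]
    ext i
    fin_cases i <;> simp
  · rintro _ ⟨t, -, x, -, y, -, z, -, -, -, rfl⟩ _ ⟨t', -, x', -, y', -, z', -, -, -, rfl⟩
    rw [key, key]
    simp only [hermF_add_left, hermF_add_right, hermF_smul_left, hermF_smul_right, ha, hb, hc, hd,
      hab, hba, hac, hca, hbc, hcb, hda, had, hdb, hbd, hdc, hcd]
    simp [hermF, Fin.sum_univ_four]
    ring

/-! ### The decomposition -/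

/-- `M` is isometric to one of the four indecomposable Eisenstein root lattices. -/
def IsIndecomposableType (M : Set (Fin n → ℂ)) : Prop :=
  LatIsom M A2L ∨ LatIsom M D4L ∨ LatIsom M E6L ∨ LatIsom M E8L

lemma exists_component (hL : ThetaIntegral L) {r : Fin n → ℂ} (hr : r ∈ L)
    (hr3 : hermF r r = 3) :
    ∃ M ≤ L, IsIndecomposableType (M : Set (Fin n → ℂ)) ∧ (∃ x ∈ M, x ≠ 0) ∧ RootSplits L M := by
  obtain ⟨b, hb, hA⟩ : ∃ b : Fin n → ℂ, hermF b b = 1 ∧ A2Of b ≤ L := by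
    refine ⟨(-θ / 3) • r, ?_, ?_⟩
    · rw [hermF_smul_left, hermF_smul_right, hr3, map_div₀, map_neg, conj_theta, map_ofNat]
      linear_combination (-1 / 3 : ℂ) * theta_sq
    · rintro _ ⟨_, ⟨e, he, rfl⟩, rfl⟩
      rw [smul_smul, show θ * e * (-θ / 3) = e by linear_combination (-e / 3) * theta_sq]
      exact smul_mem_of_mem_Eis L he hr
  rcases A2Of_splits_or_extends hL hb hA with h | ⟨a, ha, hab, hD⟩
  · exact ⟨_, hA, .inl (latIsom_A2Of hb),
      ⟨_, theta_smul_mem_A2Of b, theta_smul_ne_zero hb⟩, h⟩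
  rcases D4Of_splits_or_extends hL ha hb hab hD with h | ⟨e₁, e₂, h₁, h₂, h₁₂, h₁b, h₂b, hE⟩
  · exact ⟨_, hD, .inr (.inl (latIsom_D4Of ha hb hab)),
      ⟨_, theta_smul_mem_D4Of a b, theta_smul_ne_zero hb⟩, h⟩
  rcases E6Of_splits_or_extends hL h₁ h₂ hb h₁₂ h₁b h₂b hE with h | ⟨d, hd, hd₁, hd₂, hdb, hF⟩
  · exact ⟨_, hE, .inr (.inr (.inl (latIsom_E6Of h₁ h₂ hb h₁₂ h₁b h₂b))),
      ⟨_, theta_smul_mem_E6Of e₁ e₂ b, theta_smul_ne_zero hb⟩, h⟩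
  · exact ⟨_, hF, .inr (.inr (.inr (latIsom_E8Of hd h₁ h₂ hb hd₁ hd₂ hdb h₁₂ h₁b h₂b))),
      ⟨_, theta_smul_mem_E8Of d e₁ e₂ b, theta_smul_ne_zero hb⟩,
      E8Of_splits hL hd h₁ h₂ hb hd₁ hd₂ hdb h₁₂ h₁b h₂b hF⟩

lemma exists_orthogonal_decomposition (L : Submodule Eis (Fin n → ℂ)) (hL : ThetaIntegral L)
    (hroots : L ≤ Submodule.span Eis {r | r ∈ L ∧ hermF r r = 3}) :
    ∃ (k : ℕ) (M : Fin k → Submodule Eis (Fin n → ℂ)),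
      (∀ j, M j ≤ L) ∧ (∀ j, IsIndecomposableType (M j : Set (Fin n → ℂ))) ∧
      (∀ j j', j ≠ j' → ∀ x ∈ M j, ∀ y ∈ M j', hermF x y = 0) ∧
      ∀ x ∈ L, ∃ m : Fin k → (Fin n → ℂ), (∀ j, m j ∈ M j) ∧ x = ∑ j, m j := by
  induction hd : Module.finrank ℂ (Submodule.span ℂ (L : Set (Fin n → ℂ))) using
    Nat.strong_induction_on generalizing L with
  | _ d ih =>
  by_cases hr : ∃ r ∈ L, hermF r r = 3
  swap
  · refine ⟨0, Fin.elim0, fun j => j.elim0, fun j => j.elim0, fun j => j.elim0, fun x hx => ?_⟩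
    have hempty : {r | r ∈ L ∧ hermF r r = 3} = ∅ :=
      Set.eq_empty_iff_forall_notMem.2 fun r h => hr ⟨r, h⟩
    rw [hempty, Submodule.span_empty] at hroots
    exact ⟨0, fun j => j.elim0, by simpa using hroots hx⟩
  obtain ⟨r, hrL, hr3⟩ := hr
  obtain ⟨M, hML, hMT, ⟨x₀, hx₀, hx₀0⟩, hsplit⟩ := exists_component hL hrL hr3
  set S : Set (Fin n → ℂ) := {s | s ∈ L ∧ hermF s s = 3 ∧ ∀ x ∈ M, hermF x s = 0} with hS
  set L' := Submodule.span Eis S with hL'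
  have hL'L : L' ≤ L := Submodule.span_le.2 fun s hs => hs.1
  have hperp : ∀ y ∈ Submodule.span ℂ (L' : Set (Fin n → ℂ)), ∀ x ∈ M, hermF y x = 0 := by
    intro y hy x hx
    have : Submodule.span ℂ (L' : Set (Fin n → ℂ)) ≤ LinearMap.ker (hermLeft x) := by
      rw [hL', Submodule.span_span_of_tower, Submodule.span_le]
      exact fun s hs => hermF_symm_zero (hs.2.2 x hx)
    exact this hy
  have hlt : Submodule.span ℂ (L' : Set (Fin n → ℂ)) < Submodule.span ℂ (L : Set (Fin n → ℂ)) := by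
    refine lt_of_le_not_ge (Submodule.span_mono hL'L) fun h => hx₀0 ?_
    exact hermF_self_eq_zero.1 (hperp _ (h (Submodule.subset_span (hML hx₀))) _ hx₀)
  obtain ⟨k, N, hNL, hNT, hNo, hN⟩ := ih _ (hd ▸ Submodule.finrank_lt_finrank_of_lt hlt) L'
    (fun x hx y hy => hL x (hL'L hx) y (hL'L hy))
    (Submodule.span_mono fun s hs => ⟨Submodule.subset_span hs, hs.2.1⟩) rfl
  have hNM : ∀ j, ∀ y ∈ N j, ∀ x ∈ M, hermF y x = 0 := fun j y hy =>
    hperp y (Submodule.subset_span (hNL j hy))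
  refine ⟨k + 1, Fin.cons M N, fun j => ?_, fun j => ?_, fun j j' => ?_, fun x hx => ?_⟩
  · cases j using Fin.cases with
    | zero => exact hML
    | succ j => exact (hNL j).trans hL'L
  · cases j using Fin.cases with
    | zero => exact hMT
    | succ j => exact hNT j
  · cases j using Fin.cases with
    | zero =>
      cases j' using Fin.cases with
      | zero => exact fun h => absurd rfl h
      | succ j' => exact fun _ x hx y hy => hermF_symm_zero (hNM j' y hy x hx)
    | succ j =>
      cases j' using Fin.cases with
      | zero => exact fun _ x hx y hy => hNM j x hx y hy
      | succ j' => exact fun h => hNo j j' fun h' => h (congrArg Fin.succ h')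
  · have hle : L ≤ M ⊔ L' := hroots.trans <| Submodule.span_le.2 fun s hs => by
      rcases hsplit s hs.1 hs.2 with h | h
      · exact Submodule.mem_sup_left h
      · exact Submodule.mem_sup_right (Submodule.subset_span ⟨hs.1, hs.2, h⟩)
    obtain ⟨m₀, hm₀, y, hy, rfl⟩ := Submodule.mem_sup.1 (hle hx)
    obtain ⟨m, hm, rfl⟩ := hN y hy
    refine ⟨Fin.cons m₀ m, fun j => ?_, by simp [Fin.sum_univ_succ]⟩
    cases j using Fin.cases with
    | zero => exact hm₀
    | succ j => exact hm j

lemma eq_of_sum_eq_of_orthogonal {k : ℕ} {M : Fin k → Submodule Eis (Fin n → ℂ)}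
    (ho : ∀ j j', j ≠ j' → ∀ x ∈ M j, ∀ y ∈ M j', hermF x y = 0) {m m' : Fin k → (Fin n → ℂ)}
    (hm : ∀ j, m j ∈ M j) (hm' : ∀ j, m' j ∈ M j) (h : ∑ j, m j = ∑ j, m' j) : m = m' := by
  ext1 j
  rw [← sub_eq_zero, ← hermF_self_eq_zero]
  have h0 : hermF (∑ i, (m i - m' i)) (m j - m' j) = 0 := by
    rw [Finset.sum_sub_distrib, h, sub_self, hermF_zero_left]
  rwa [hermF_sum_left, Finset.sum_eq_single j
    (fun i _ hij => ho i j hij _ (sub_mem (hm i) (hm' i)) _ (sub_mem (hm j) (hm' j)))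
    (fun hj => absurd (Finset.mem_univ j) hj)] at h0

end Lattice

/-- Every Eisenstein root lattice is an orthogonal direct sum of copies of
`A₂^E`, `D₄^E`, `E₆^E` and `E₈^E`. -/
theorem stmt13 {n : ℕ} (L : Set (Fin n → ℂ))
    (h0 : (0 : Fin n → ℂ) ∈ L)
    (hadd : ∀ x ∈ L, ∀ y ∈ L, x + y ∈ L)
    (hneg : ∀ x ∈ L, -x ∈ L)
    (hω : ∀ x ∈ L, ω • x ∈ L)
    (hdiv : ∀ x ∈ L, ∀ y ∈ L, ∃ e ∈ Eis, hermF x y = θ * e)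
    (hspan : ∀ x ∈ L, ∃ (k : ℕ) (c : Fin k → ℂ) (r : Fin k → (Fin n → ℂ)),
      (∀ j, c j ∈ Eis) ∧ (∀ j, r j ∈ L ∧ hermF (r j) (r j) = 3) ∧ x = ∑ j, c j • r j) :
    ∃ (k : ℕ) (M : Fin k → Set (Fin n → ℂ)),
      (∀ j, M j ⊆ L) ∧
      (∀ j, LatIsom (M j) A2L ∨ LatIsom (M j) D4L ∨
            LatIsom (M j) E6L ∨ LatIsom (M j) E8L) ∧
      (∀ j j', j ≠ j' → ∀ x ∈ M j, ∀ y ∈ M j', hermF x y = 0) ∧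
      (∀ x ∈ L, ∃! m : Fin k → (Fin n → ℂ),
        (∀ j, m j ∈ M j) ∧ x = ∑ j, m j) := by
  let Λ : Submodule Eis (Fin n → ℂ) :=
    { carrier := L
      zero_mem' := h0
      add_mem' := fun {x y} hx hy => hadd x hx y hy
      smul_mem' := by
        rintro ⟨c, hc⟩ x hx
        change c • x ∈ L
        induction hc using Subring.closure_induction generalizing x with
        | mem c hc => exact Set.mem_singleton_iff.1 hc ▸ hω x hx
        | zero => simpa using h0
        | one => simpa using hx
        | add c d _ _ ihc ihd => rw [add_smul]; exact hadd _ (ihc hx) _ (ihd hx)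
        | neg c _ ihc => rw [neg_smul]; exact hneg _ (ihc hx)
        | mul c d _ _ ihc ihd => rw [mul_smul]; exact ihc (ihd hx) }
  have hroots : Λ ≤ Submodule.span Eis {r | r ∈ Λ ∧ hermF r r = 3} := by
    intro x hx
    obtain ⟨k, c, r, hc, hr, rfl⟩ := hspan x hx
    exact sum_mem fun j _ => smul_mem_of_mem_Eis _ (hc j) (Submodule.subset_span (hr j))
  obtain ⟨k, M, hML, hMT, hMo, hM⟩ := exists_orthogonal_decomposition Λ hdiv hroots
  refine ⟨k, fun j => M j, hML, hMT, hMo, fun x hx => ?_⟩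
  obtain ⟨m, hm, hxm⟩ := hM x hx
  exact ⟨m, ⟨hm, hxm⟩, fun m' hm' =>
    eq_of_sum_eq_of_orthogonal hMo hm'.1 hm (hm'.2.symm.trans hxm)⟩
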